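/- Let N ≥ 2, s ∈ (0,1), and τ > −N, and define h : (0,1) → ℝ by h(t) = ∫_{B_t(0)} (1 − |z|^τ)/|e_1−z|^{N+2s} dz. Then there exists a constant c = c(τ,s,N) > 0 such that |h(t)| ≤ c (t^N + t^{N+τ}) for all t ∈ (0,1/2], and for all t ∈ [1/2,1): |h(t)| ≤ c if s ∈ (0,1/2); |h(t)| ≤ c |ln(1−t)| if s = 1/2; |h(t)| ≤ c (1−t)^{1−2s} if s ∈ (1/2,1). -/

import Mathlib

open MeasureTheory Filter Set Topology Metric

noncomputable section

/-- Euclidean space `ℝ^N`. -/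
abbrev EN (N : ℕ) := EuclideanSpace ℝ (Fin N)

/-- The normalizing constant `C_{N,s}` of the fractional Laplacian. -/
def CNs (N : ℕ) (s : ℝ) : ℝ :=
  2 ^ (2*s) * Real.pi ^ (-(N:ℝ)/2) * s * Real.Gamma ((N + 2*s)/2) / Real.Gamma (1 - s)

/-- The optimal fractional Hardy constant `μ₀`. -/
def mu0 (N : ℕ) (s : ℝ) : ℝ :=
  -(2 ^ (2*s) * Real.Gamma ((N + 2*s)/4) ^ 2 / Real.Gamma ((N - 2*s)/4) ^ 2)

/-- The function `τ ↦ c_s(τ)`. -/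
def csFun (N : ℕ) (s τ : ℝ) : ℝ :=
  2 ^ (2*s) * Real.Gamma ((N + τ)/2) * Real.Gamma ((2*s - τ)/2) /
    (Real.Gamma (-τ/2) * Real.Gamma ((N - 2*s + τ)/2))

/-- `u` has fractional Laplacian `(-Δ)^s u (x) = L` at `x`, as a principal value. -/
def HasFracLap (N : ℕ) (s : ℝ) (u : EN N → ℝ) (x : EN N) (L : ℝ) : Prop :=
  Tendsto (fun ε : ℝ =>
      CNs N s * ∫ z in {z : EN N | ε ≤ dist x z}, (u x - u z) / dist x z ^ ((N:ℝ) + 2*s))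
    (𝓝[>] 0) (𝓝 L)

/-- `v` has weighted fractional Laplacian `(-Δ)^s_{Γ_μ} v (x) = L` at `x`, where the weight
is `Γ_μ(z) = ‖z‖ ^ τp` with `τp = τ₊(s,μ)`. -/
def HasWFracLap (N : ℕ) (s τp : ℝ) (v : EN N → ℝ) (x : EN N) (L : ℝ) : Prop :=
  Tendsto (fun ε : ℝ =>
      CNs N s * ∫ z in {z : EN N | ε ≤ dist x z},
        (v x - v z) * ‖z‖ ^ τp / dist x z ^ ((N:ℝ) + 2*s))
    (𝓝[>] 0) (𝓝 L)

/-- Membership in `L¹(ℝ^N, dx/(1+|x|^{N+2s}))`. -/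
def MemL1w (N : ℕ) (s : ℝ) (u : EN N → ℝ) : Prop :=
  Integrable (fun x : EN N => u x / (1 + ‖x‖ ^ ((N:ℝ) + 2*s)))

/-- Membership in `L^∞_loc(ℝ^N \ {0})`. -/
def LocBddAway (N : ℕ) (u : EN N → ℝ) : Prop :=
  ∀ K : Set (EN N), IsCompact K → (0:EN N) ∉ K → ∃ C : ℝ, ∀ x ∈ K, |u x| ≤ C

/-- Local `θ`-Hölder continuity on compact subsets of `S`, i.e. `C^θ_loc(S)`. -/
def HolderLocOn (N : ℕ) (θ : ℝ) (f : EN N → ℝ) (S : Set (EN N)) : Prop :=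
  ∀ K ⊆ S, IsCompact K → ∃ C : ℝ, ∀ x ∈ K, ∀ y ∈ K, |f x - f y| ≤ C * dist x y ^ θ

/-- Membership in `L^∞_loc(S)`. -/
def LinfLocOn (N : ℕ) (f : EN N → ℝ) (S : Set (EN N)) : Prop :=
  AEMeasurable f ∧ ∀ K ⊆ S, IsCompact K → ∃ C : ℝ, ∀ x ∈ K, |f x| ≤ C

/-- A bounded `C²` domain: open, connected and bounded, whose boundary is the regular zero
level set of a `C²` defining function. -/
structure IsBoundedC2Domain (N : ℕ) (Ω : Set (EN N)) : Prop where
  isOpen : IsOpen Ω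
  isConnected : IsConnected Ω
  isBounded : Bornology.IsBounded Ω
  c2Boundary : ∃ φ : EN N → ℝ, ContDiff ℝ 2 φ ∧ Ω = {x | φ x < 0} ∧
    ∀ x ∈ frontier Ω, fderiv ℝ φ x ≠ 0

/-- A bounded domain: open, connected and bounded. -/
def IsBoundedDomain (N : ℕ) (Ω : Set (EN N)) : Prop :=
  IsOpen Ω ∧ IsConnected Ω ∧ Bornology.IsBounded Ω

/-- The first standard coordinate vector `e₁ ∈ ℝ^N`. -/
def e1 (N : ℕ) : EN N :=
  (EuclideanSpace.equiv (Fin N) ℝ).symm (fun i => if (i:ℕ) = 0 then 1 else 0)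

/-- The surface measure `ω_{N-1}` of the unit sphere in `ℝ^N`. -/
def omegaN (N : ℕ) : ℝ := N * (volume (ball (0 : EN N) 1)).toReal

/-- The normalization constant `c_{s,0}`. -/
def cs0 (N : ℕ) (s : ℝ) : ℝ :=
  CNs N s * omegaN N * ∫ t in Ioo (0:ℝ) 1, ∫ z in ball (0:EN N) t,
    (‖z‖ ^ (2*s - N) - 1) / ‖e1 N - z‖ ^ ((N:ℝ) + 2*s)

/-- The fundamental solution `Φ_μ`, expressed via the exponent `τ = τ₋(s,μ)`:
`Φ_μ(x) = |x|^τ` for `μ ≠ μ₀` and `Φ_{μ₀}(x) = -|x|^τ ln |x|`. -/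
def Phi (N : ℕ) (s μ τ : ℝ) (x : EN N) : ℝ :=
  if μ = mu0 N s then -(‖x‖ ^ τ * Real.log ‖x‖) else ‖x‖ ^ τ

/-- The integrand appearing in the definition of `c_{s,μ}`. -/
def cIntegrand (N : ℕ) (s μ τm τp : ℝ) (z : EN N) : ℝ :=
  if μ = mu0 N s then ‖z‖ ^ ((2*s - N)/2) * (-Real.log ‖z‖) / ‖e1 N - z‖ ^ ((N:ℝ) + 2*s)
  else (‖z‖ ^ τm - ‖z‖ ^ τp) / ‖e1 N - z‖ ^ ((N:ℝ) + 2*s)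

/-- The normalization constant `c_{s,μ}`. -/
def csmu (N : ℕ) (s μ τm τp : ℝ) : ℝ :=
  CNs N s * omegaN N * ∫ t in Ioo (0:ℝ) 1, ∫ z in ball (0:EN N) t, cIntegrand N s μ τm τp z

/-- The weight `Λ_μ`, expressed via `τp = τ₊(s,μ)`. -/
def Lam (N : ℕ) (s τp : ℝ) (x : EN N) : ℝ :=
  if 2*s - 1 < τp then 1
  else if τp < 2*s - 1 then ‖x‖ ^ (1 - 2*s + τp)
  else 1 + max (-Real.log ‖x‖) 0

/-- The quadratic form `E^s(u,v)`. -/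
def Es (N : ℕ) (s : ℝ) (u v : EN N → ℝ) : ℝ :=
  (CNs N s / 2) *
    ∫ p : EN N × EN N, (u p.1 - u p.2) * (v p.1 - v p.2) / dist p.1 p.2 ^ ((N:ℝ) + 2*s)

/-- The quadratic form `E^s_μ(u,v)`. -/
def Esmu (N : ℕ) (s μ : ℝ) (u v : EN N → ℝ) : ℝ :=
  Es N s u v + μ * ∫ x : EN N, u x * v x / ‖x‖ ^ (2*s)

/-- `E^s_{A,B}(u,u) < ∞`. -/
def FiniteEnergyOn (N : ℕ) (s : ℝ) (u : EN N → ℝ) (A B : Set (EN N)) : Prop :=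
  IntegrableOn (fun p : EN N × EN N => (u p.1 - u p.2)^2 / dist p.1 p.2 ^ ((N:ℝ) + 2*s)) (A ×ˢ B)

/-- Membership in `H^s(ℝ^N)`: locally `L²` with finite Gagliardo seminorm. -/
def MemHs (N : ℕ) (s : ℝ) (u : EN N → ℝ) : Prop :=
  (∀ K : Set (EN N), IsCompact K → IntegrableOn (fun x => (u x)^2) K) ∧
  FiniteEnergyOn N s u univ univ

/-- Membership in `H^s_0(Ω)`. -/
def MemHs0 (N : ℕ) (s : ℝ) (Ω : Set (EN N)) (u : EN N → ℝ) : Prop :=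
  MemHs N s u ∧ ∀ᵐ x : EN N, x ∉ Ω → u x = 0

/-- Membership in `W^s(Ω)`. -/
def MemWs (N : ℕ) (s : ℝ) (Ω : Set (EN N)) (u : EN N → ℝ) : Prop :=
  MemL1w N s u ∧ IntegrableOn (fun x => (u x)^2) Ω ∧
  ∃ Ω' : Set (EN N), IsOpen Ω' ∧ IsConnected Ω' ∧ closure Ω ⊆ Ω' ∧ FiniteEnergyOn N s u Ω Ω'

/-- Membership in `W^s_*(Ω)`. -/
def MemWsStar (N : ℕ) (s : ℝ) (Ω : Set (EN N)) (u : EN N → ℝ) : Prop :=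
  MemL1w N s u ∧ ∀ ε : ℝ, 0 < ε → MemWs N s (Ω \ closedBall 0 ε) u

/-- The distributional identity `L^s_μ u = f` in `Ω \ {0}`, tested against `C^∞_c(Ω\{0})`. -/
def DistrEq (N : ℕ) (s μ : ℝ) (Ω : Set (EN N)) (f u : EN N → ℝ) : Prop :=
  ∀ φ : EN N → ℝ, ContDiff ℝ (⊤ : ℕ∞) φ → HasCompactSupport φ → tsupport φ ⊆ Ω \ {0} →
    ∀ g : EN N → ℝ, (∀ x, HasFracLap N s φ x (g x)) →
      (∫ x, u x * g x) + μ * ∫ x, u x * φ x / ‖x‖ ^ (2*s) = ∫ x in Ω, f x * φ x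

/-- A distributional solution of `L^s_μ u = f` in `Ω \ {0}` with `u = 0` in `ℝ^N \ Ω`. -/
def IsDistrSol (N : ℕ) (s μ : ℝ) (Ω : Set (EN N)) (f u : EN N → ℝ) : Prop :=
  LocBddAway N u ∧ MemL1w N s u ∧ (∀ x ∉ Ω, u x = 0) ∧ DistrEq N s μ Ω f u

lemma aux_radial (N : ℕ) (hN : 2 ≤ N) (p a b : ℝ) (ha : 0 ≤ a) (hab : a ≤ b)
    (hi : IntervalIntegrable (fun x : ℝ => x ^ ((N:ℝ) - 1 + p)) volume a b) :
    Integrable (fun z : EN N => (Ioc a b).indicator (fun r : ℝ => r ^ p) ‖z‖) ∧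
    ∫ z : EN N, (Ioc a b).indicator (fun r : ℝ => r ^ p) ‖z‖ =
      omegaN N * ∫ x in a..b, x ^ ((N:ℝ) - 1 + p) := by
  haveI : Nonempty (Fin N) := ⟨⟨0, by omega⟩⟩
  haveI : Nontrivial (EN N) := by
    apply Module.nontrivial_of_finrank_pos (R := ℝ)
    rw [finrank_euclideanSpace_fin]; omega
  have key : ∀ x ∈ Ioi (0:ℝ), x ^ (N - 1) • (Ioc a b).indicator (fun r : ℝ => r ^ p) x
      = (Ioc a b).indicator (fun x : ℝ => x ^ ((N:ℝ) - 1 + p)) x := by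
    intro x hx
    by_cases h : x ∈ Ioc a b
    · rw [indicator_of_mem h, indicator_of_mem h, Real.rpow_add hx, smul_eq_mul,
        ← Real.rpow_natCast, Nat.cast_sub (by omega)]
      simp
    · simp [h]
  have hsub : Ioc a b ∩ Ioi 0 = Ioc a b := by
    apply inter_eq_left.2
    intro x hx
    exact lt_of_le_of_lt ha hx.1
  constructor
  · rw [integrable_fun_norm_addHaar volume (f := (Ioc a b).indicator (fun r : ℝ => r ^ p)),
      finrank_euclideanSpace_fin, integrableOn_congr_fun key measurableSet_Ioi]
    apply Integrable.integrableOn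
    rw [integrable_indicator_iff measurableSet_Ioc]
    exact (intervalIntegrable_iff_integrableOn_Ioc_of_le hab).1 hi
  · rw [integral_fun_norm_addHaar volume (Ioc a b |>.indicator (fun r : ℝ => r ^ p)),
      finrank_euclideanSpace_fin, setIntegral_congr_fun measurableSet_Ioi key,
      setIntegral_indicator measurableSet_Ioc, inter_comm, hsub,
      intervalIntegral.integral_of_le hab]
    simp [omegaN, Measure.real, mul_assoc]

lemma aux_dom (N : ℕ) (hN : 2 ≤ N) (f G : EN N → ℝ) (hf : Measurable f) (hG : Integrable G)
    (hG0 : ∀ z, 0 ≤ G z) (t : ℝ)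
    (h : ∀ z : EN N, z ≠ 0 → z ∈ ball (0 : EN N) t → |f z| ≤ G z) :
    IntegrableOn f (ball (0 : EN N) t) ∧ |∫ z in ball (0 : EN N) t, f z| ≤ ∫ z, G z := by
  haveI : Nontrivial (EN N) := by
    apply Module.nontrivial_of_finrank_pos (R := ℝ)
    rw [finrank_euclideanSpace_fin]; omega
  have hne : ∀ᵐ z : EN N, z ≠ 0 := by
    simp [ae_iff]
  have hae : ∀ᵐ z : EN N, ‖(ball (0 : EN N) t).indicator f z‖ ≤ G z := by
    filter_upwards [hne] with z hz
    by_cases hzt : z ∈ ball (0 : EN N) t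
    · rw [indicator_of_mem hzt]; exact h z hz hzt
    · rw [indicator_of_notMem hzt]; simpa using hG0 z
  constructor
  · rw [← integrable_indicator_iff measurableSet_ball]
    exact Integrable.mono' hG (hf.indicator measurableSet_ball).aestronglyMeasurable hae
  · rw [← integral_indicator measurableSet_ball]
    exact norm_integral_le_of_norm_le hG hae

lemma aux_exp (x : ℝ) : |Real.exp x - 1| ≤ |x| * Real.exp |x| := by
  have h1 := Real.add_one_le_exp x
  have h2 := Real.add_one_le_exp (-x)
  have h3 : Real.exp x * Real.exp (-x) = 1 := by rw [← Real.exp_add]; simp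
  have h4 := Real.exp_pos x
  have h5 : Real.exp x - 1 ≤ x * Real.exp x := by nlinarith
  have h6 : x * Real.exp x ≤ |x| * Real.exp |x| := by
    have := Real.exp_le_exp.2 (le_abs_self x)
    have := le_abs_self x
    have := abs_nonneg x
    nlinarith
  have h7 : |x| ≤ |x| * Real.exp |x| := by
    have := Real.one_le_exp (abs_nonneg x)
    nlinarith [abs_nonneg x]
  rw [abs_le]
  constructor
  · linarith [neg_abs_le x]
  · linarith

lemma aux_pow (τ r : ℝ) (h1 : 1/2 ≤ r) (h2 : r ≤ 1) :
    |1 - r ^ τ| ≤ 2 * |τ| * Real.exp |τ| * (1 - r) := by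
  have hr : 0 < r := by linarith
  have hl0 : Real.log r ≤ 0 := Real.log_nonpos hr.le h2
  have hl : |Real.log r| ≤ 2 * (1 - r) := by
    rw [abs_of_nonpos hl0]
    have := Real.one_sub_inv_le_log_of_pos hr
    have h3 : r⁻¹ - 1 ≤ 2 * (1 - r) := by
      have : r⁻¹ - 1 = (1 - r) * r⁻¹ := by field_simp
      rw [this]
      have : r⁻¹ ≤ 2 := by
        rw [inv_le_comm₀ hr (by norm_num)]; linarith
      nlinarith
    linarith
  rw [abs_sub_comm, Real.rpow_def_of_pos hr]
  refine (aux_exp _).trans ?_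
  rw [abs_mul]
  have e1 : |Real.log r| * |τ| ≤ 2 * (1 - r) * |τ| := by gcongr
  have e2 : |Real.log r| * |τ| ≤ |τ| := by
    have : |Real.log r| ≤ 1 := by linarith
    nlinarith [abs_nonneg τ]
  calc |Real.log r| * |τ| * Real.exp (|Real.log r| * |τ|)
      ≤ 2 * (1 - r) * |τ| * Real.exp |τ| := by gcongr
    _ = _ := by ring

lemma aux_e1 (N : ℕ) (hN : 2 ≤ N) : ‖e1 N‖ = 1 := by
  have : e1 N = EuclideanSpace.single (⟨0, by omega⟩ : Fin N) (1:ℝ) := by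
    ext i
    simp [e1, Pi.single_apply, Fin.ext_iff]
  rw [this]; simp

/-- Bound near the origin. -/
lemma aux_near (N : ℕ) (hN : 2 ≤ N) (s : ℝ) (hs : 0 < s) (τ : ℝ) (z : EN N) (hz : ‖z‖ ≤ 1/2) :
    |(1 - ‖z‖ ^ τ) / ‖e1 N - z‖ ^ ((N:ℝ) + 2*s)| ≤ 2 ^ ((N:ℝ) + 2*s) * (1 + ‖z‖ ^ τ) := by
  have h1 : 1/2 ≤ ‖e1 N - z‖ := by
    have := norm_sub_norm_le (e1 N) z
    rw [aux_e1 N hN] at this; linarith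
  have hq : (0:ℝ) ≤ (N:ℝ) + 2*s := by positivity
  have h2 : (1/2 : ℝ) ^ ((N:ℝ) + 2*s) ≤ ‖e1 N - z‖ ^ ((N:ℝ) + 2*s) :=
    Real.rpow_le_rpow (by norm_num) h1 hq
  have h3 : (2:ℝ) ^ ((N:ℝ) + 2*s) * (1/2 : ℝ) ^ ((N:ℝ) + 2*s) = 1 := by
    rw [← Real.mul_rpow (by norm_num) (by norm_num)]; norm_num
  have h4 : 0 < ‖e1 N - z‖ ^ ((N:ℝ) + 2*s) := lt_of_lt_of_le (by positivity) h2
  have h5 : 0 ≤ ‖z‖ ^ τ := by positivity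
  rw [abs_div, abs_of_pos h4, div_le_iff₀ h4]
  have h6 : |1 - ‖z‖ ^ τ| ≤ 1 + ‖z‖ ^ τ := by
    rw [abs_le]; constructor <;> linarith
  have h7 : 1 ≤ (2:ℝ) ^ ((N:ℝ) + 2*s) * ‖e1 N - z‖ ^ ((N:ℝ) + 2*s) := by
    rw [← h3]; gcongr
  nlinarith

/-- Bound away from the origin. -/
lemma aux_far (N : ℕ) (hN : 2 ≤ N) (s : ℝ) (τ : ℝ) (z : EN N) (hz : 1/2 ≤ ‖z‖)
    (hz1 : ‖z‖ < 1) :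
    |(1 - ‖z‖ ^ τ) / ‖e1 N - z‖ ^ ((N:ℝ) + 2*s)| ≤
      2 * |τ| * Real.exp |τ| * ‖e1 N - z‖ ^ (1 - (N:ℝ) - 2*s) := by
  have h1 : 1 - ‖z‖ ≤ ‖e1 N - z‖ := by
    have := norm_sub_norm_le (e1 N) z
    rwa [aux_e1 N hN] at this
  have h0 : 0 < ‖e1 N - z‖ := by linarith
  have h4 : 0 < ‖e1 N - z‖ ^ ((N:ℝ) + 2*s) := by positivity
  rw [abs_div, abs_of_pos h4, div_le_iff₀ h4, mul_assoc _ (_ ^ _), ← Real.rpow_add h0]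
  have : 1 - (N:ℝ) - 2*s + (N + 2*s) = 1 := by ring
  rw [this, Real.rpow_one]
  refine (aux_pow τ _ hz hz1.le).trans ?_
  gcongr

lemma aux_log (d : ℝ) (h0 : 0 < d) (h1 : d ≤ 1/2) :
    1/2 ≤ |Real.log d| ∧ Real.log (2 / d) ≤ 2 * |Real.log d| := by
  have hl : Real.log d ≤ Real.log (1/2) := Real.log_le_log h0 h1
  have h2 : Real.log (1/2) = - Real.log 2 := by rw [one_div, Real.log_inv]
  have := Real.log_two_gt_d9
  rw [abs_of_nonpos (by linarith), Real.log_div (by norm_num) h0.ne']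
  constructor <;> linarith

lemma aux_omega (N : ℕ) : 0 ≤ omegaN N := by unfold omegaN; positivity

/-- Lemma 3.3: estimates for `h(t) = ∫_{B_t} (1-|z|^τ)/|e₁-z|^{N+2s} dz`. -/
theorem h_integral_estimates
    (N : ℕ) (hN : 2 ≤ N) (s : ℝ) (hs : s ∈ Ioo (0:ℝ) 1) (τ : ℝ) (hτ : -(N:ℝ) < τ) :
    (∀ t ∈ Ioo (0:ℝ) 1,
      IntegrableOn (fun z : EN N => (1 - ‖z‖ ^ τ) / ‖e1 N - z‖ ^ ((N:ℝ) + 2*s))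
        (ball (0:EN N) t)) ∧
    ∃ c : ℝ, 0 < c ∧
      (∀ t ∈ Ioc (0:ℝ) (1/2),
        |∫ z in ball (0:EN N) t, (1 - ‖z‖ ^ τ) / ‖e1 N - z‖ ^ ((N:ℝ) + 2*s)| ≤
          c * (t ^ (N:ℝ) + t ^ ((N:ℝ) + τ))) ∧
      (∀ t ∈ Ico (1/2 : ℝ) 1,
        (s < 1/2 →
          |∫ z in ball (0:EN N) t, (1 - ‖z‖ ^ τ) / ‖e1 N - z‖ ^ ((N:ℝ) + 2*s)| ≤ c) ∧
        (s = 1/2 →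
          |∫ z in ball (0:EN N) t, (1 - ‖z‖ ^ τ) / ‖e1 N - z‖ ^ ((N:ℝ) + 2*s)| ≤
            c * |Real.log (1 - t)|) ∧
        (1/2 < s →
          |∫ z in ball (0:EN N) t, (1 - ‖z‖ ^ τ) / ‖e1 N - z‖ ^ ((N:ℝ) + 2*s)| ≤
            c * (1 - t) ^ (1 - 2*s))) := by
  obtain ⟨hs0, hs1⟩ := hs
  have hNr : (2:ℝ) ≤ N := by exact_mod_cast hN
  set f : EN N → ℝ := fun z => (1 - ‖z‖ ^ τ) / ‖e1 N - z‖ ^ ((N:ℝ) + 2*s) with hfdef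
  have hf : Measurable f := by
    rw [hfdef]
    fun_prop
  set A : ℝ := 2 ^ ((N:ℝ) + 2*s) with hA
  have hA0 : 0 < A := by positivity
  set C : ℝ := 2 * |τ| * Real.exp |τ| with hC
  have hC0 : 0 ≤ C := by positivity
  set K := omegaN N with hK
  have hK0 : 0 ≤ K := aux_omega N
  -- radial powers on the ball
  have hball : ∀ p : ℝ, -(N:ℝ) < p → ∀ t : ℝ, 0 < t →
      Integrable (fun z : EN N => (Ioc 0 t).indicator (fun r : ℝ => r ^ p) ‖z‖) ∧
      ∫ z : EN N, (Ioc 0 t).indicator (fun r : ℝ => r ^ p) ‖z‖ =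
        K * (t ^ ((N:ℝ) + p) / (N + p)) := by
    intro p hp t ht
    have := aux_radial N hN p 0 t le_rfl ht.le
      (intervalIntegral.intervalIntegrable_rpow' (by linarith))
    refine ⟨this.1, ?_⟩
    rw [this.2, integral_rpow (Or.inl (by linarith))]
    have e : (N:ℝ) - 1 + p + 1 = N + p := by ring
    rw [e, Real.zero_rpow (by linarith), sub_zero]
  -- near part
  let G₁ : ℝ → EN N → ℝ := fun t z => A * ((Ioc 0 t).indicator (fun r : ℝ => r ^ (0:ℝ)) ‖z‖
    + (Ioc 0 t).indicator (fun r : ℝ => r ^ τ) ‖z‖)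
  have hG₁i : ∀ t, 0 < t → Integrable (G₁ t) := fun t ht =>
    ((hball 0 (by linarith) t ht).1.add (hball τ hτ t ht).1).const_mul A
  have hG₁v : ∀ t, 0 < t → ∫ z, G₁ t z =
      A * (K * (t ^ (N:ℝ) / N) + K * (t ^ ((N:ℝ) + τ) / (N + τ))) := by
    intro t ht
    simp only [G₁]
    rw [integral_const_mul, integral_add (hball 0 (by linarith) t ht).1 (hball τ hτ t ht).1,
      (hball 0 (by linarith) t ht).2, (hball τ hτ t ht).2, add_zero]
  have hG₁n : ∀ t z, 0 ≤ G₁ t z := by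
    intro t z
    have h : ∀ p : ℝ, 0 ≤ (Ioc 0 t).indicator (fun r : ℝ => r ^ p) ‖z‖ := fun p =>
      indicator_nonneg (fun r hr => Real.rpow_nonneg hr.1.le _) _
    exact mul_nonneg hA0.le (add_nonneg (h _) (h _))
  have hnear : ∀ t, ∀ z : EN N, z ≠ 0 → z ∈ ball (0 : EN N) t → ‖z‖ ≤ 1/2 →
      |f z| ≤ G₁ t z := by
    intro t z hz0 hzt hz
    have hm : ‖z‖ ∈ Ioc 0 t := ⟨norm_pos_iff.2 hz0, (mem_ball_zero_iff.1 hzt).le⟩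
    simp only [G₁]
    rw [indicator_of_mem hm, indicator_of_mem hm, Real.rpow_zero]
    exact aux_near N hN s hs0 τ z hz
  -- far part
  let H : ℝ → EN N → ℝ := fun d z =>
    C * (Ioc d 2).indicator (fun r : ℝ => r ^ (1 - (N:ℝ) - 2*s)) ‖e1 N - z‖
  have hrad : ∀ d : ℝ, 0 < d → d ≤ 1 →
      Integrable (H d) ∧ ∫ z, H d z = C * (K * ∫ x in d..2, x ^ (-(2*s))) := by
    intro d hd hd1
    have e : (N:ℝ) - 1 + (1 - N - 2*s) = -(2*s) := by ring
    have := aux_radial N hN (1 - (N:ℝ) - 2*s) d 2 hd.le (by linarith)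
      (intervalIntegral.intervalIntegrable_rpow (Or.inr (by
        rw [uIcc_of_le (by linarith)]; intro h; linarith [h.1])))
    rw [e] at this
    refine ⟨(this.1.comp_sub_left (e1 N)).const_mul C, ?_⟩
    simp only [H]
    rw [integral_const_mul, integral_sub_left_eq_self
      (fun z : EN N => (Ioc d 2).indicator (fun r : ℝ => r ^ (1 - (N:ℝ) - 2*s)) ‖z‖), this.2]
  have hHn : ∀ d, 0 < d → ∀ z, 0 ≤ H d z := fun d hd z =>
    mul_nonneg hC0 (indicator_nonneg (fun r hr => Real.rpow_nonneg (hd.le.trans hr.1.le) _) _)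
  have hfar : ∀ t, t < 1 → ∀ z : EN N, z ∈ ball (0 : EN N) t → 1/2 ≤ ‖z‖ →
      |f z| ≤ H (1 - t) z := by
    intro t ht z hzt hz
    have hzt' := mem_ball_zero_iff.1 hzt
    have hm : ‖e1 N - z‖ ∈ Ioc (1 - t) 2 := by
      have h1 := norm_sub_norm_le (e1 N) z
      have h2 := norm_sub_le (e1 N) z
      rw [aux_e1 N hN] at h1 h2
      constructor <;> linarith
    simp only [H]
    rw [indicator_of_mem hm]
    exact aux_far N hN s τ z hz (by linarith)
  have hall : ∀ t ∈ Ioo (0:ℝ) 1, IntegrableOn f (ball (0 : EN N) t) ∧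
      |∫ z in ball (0 : EN N) t, f z| ≤ ∫ z, (G₁ t z + H (1 - t) z) := by
    intro t ht
    apply aux_dom N hN f _ hf ((hG₁i t ht.1).add (hrad (1 - t) (by linarith [ht.2]) (by linarith [ht.1])).1)
    · intro z
      exact add_nonneg (hG₁n t z) (hHn _ (by linarith [ht.2]) z)
    · intro z hz0 hzt
      have h1 := hG₁n t z
      have h2 := hHn (1 - t) (by linarith [ht.2]) z
      rcases le_total ‖z‖ (1/2) with h | h
      · have := hnear t z hz0 hzt h
        simp only [Pi.add_apply]; linarith
      · have := hfar t ht.2 z hzt h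
        simp only [Pi.add_apply]; linarith
  refine ⟨fun t ht => (hall t ht).1, ?_⟩
  have hNτ : 0 < (N:ℝ) + τ := by linarith
  set M : ℝ := A * K * (1 / N + 1 / (N + τ)) with hM
  have hM0 : 0 ≤ M := by positivity
  set D : ℝ := 2 ^ (1 - 2*s) / |1 - 2*s| + 2 + 1 / |1 - 2*s| with hD
  have hD0 : 0 ≤ D := by positivity
  have hDa : 2 ^ (1 - 2*s) / |1 - 2*s| ≤ D := by
    have : 0 ≤ 1 / |1 - 2*s| := by positivity
    linarith
  have hDb : 2 ≤ D := by
    have : 0 ≤ 1 / |1 - 2*s| := by positivity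
    have : 0 ≤ (2:ℝ) ^ (1 - 2*s) / |1 - 2*s| := by positivity
    linarith
  have hDc : 1 / |1 - 2*s| ≤ D := by
    have : 0 ≤ (2:ℝ) ^ (1 - 2*s) / |1 - 2*s| := by positivity
    linarith
  have hCK : 0 ≤ C * K := by positivity
  have hCKD : 0 ≤ C * K * D := by positivity
  have hG₁b : ∀ t, 0 < t → ∫ z, G₁ t z ≤ M * (t ^ (N:ℝ) + t ^ ((N:ℝ) + τ)) := by
    intro t ht
    rw [hG₁v t ht]
    have h1 : 0 < t ^ (N:ℝ) := by positivity
    have h2 : 0 < t ^ ((N:ℝ) + τ) := by positivity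
    have : M * (t ^ (N:ℝ) + t ^ ((N:ℝ) + τ)) =
        A * (K * (t ^ (N:ℝ) / N) + K * (t ^ ((N:ℝ) + τ) / (N + τ)))
        + A * K * (t ^ (N:ℝ) / (N + τ) + t ^ ((N:ℝ) + τ) / N) := by
      rw [hM]; ring
    rw [this]
    have : 0 ≤ A * K * (t ^ (N:ℝ) / (N + τ) + t ^ ((N:ℝ) + τ) / N) := by positivity
    linarith
  refine ⟨4 * M + C * K * D + 1, by positivity, ?_, ?_⟩
  · intro t ht
    have := (aux_dom N hN f _ hf (hG₁i t ht.1) (hG₁n t) t (fun z hz0 hzt =>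
      hnear t z hz0 hzt (by have := mem_ball_zero_iff.1 hzt; linarith [ht.2]))).2
    refine this.trans ((hG₁b t ht.1).trans ?_)
    have h1 : 0 < t ^ (N:ℝ) := Real.rpow_pos_of_pos ht.1 _
    have h2 : 0 < t ^ ((N:ℝ) + τ) := Real.rpow_pos_of_pos ht.1 _
    gcongr
    linarith
  · intro t ht
    have ht0 : 0 < t := by linarith [ht.1]
    have hd0 : 0 < 1 - t := by linarith [ht.2]
    have hd1 : 1 - t ≤ 1/2 := by linarith [ht.1]
    have hb := (hall t ⟨ht0, ht.2⟩).2
    rw [integral_add (hG₁i t ht0) (hrad _ hd0 (by linarith)).1,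
      (hrad _ hd0 (by linarith)).2, ← mul_assoc] at hb
    have hG2 : ∫ z, G₁ t z ≤ 2 * M := by
      refine (hG₁b t ht0).trans ?_
      have h1 : t ^ (N:ℝ) ≤ 1 := Real.rpow_le_one ht0.le ht.2.le (by linarith)
      have h2 : t ^ ((N:ℝ) + τ) ≤ 1 := Real.rpow_le_one ht0.le ht.2.le hNτ.le
      nlinarith
    -- a generic conclusion
    have fin : ∀ X : ℝ, 1/2 ≤ X → (∫ x in (1-t)..2, x ^ (-(2*s))) ≤ D * X →
        |∫ z in ball (0 : EN N) t, f z| ≤ (4 * M + C * K * D + 1) * X := by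
      intro X hX hI
      have h1 := mul_le_mul_of_nonneg_left hI hCK
      have h2 := mul_le_mul_of_nonneg_left hX hM0
      nlinarith
    have h0 : (0:ℝ) ∉ uIcc (1 - t) 2 := by
      rw [uIcc_of_le (by linarith)]; intro h; linarith [h.1]
    have hI : s ≠ 1/2 → (∫ x in (1-t)..2, x ^ (-(2*s))) =
        (2 ^ (1 - 2*s) - (1-t) ^ (1 - 2*s)) / (1 - 2*s) := by
      intro hs'
      rw [integral_rpow (Or.inr ⟨fun h => hs' (by linarith), h0⟩)]
      rw [show -(2*s) + 1 = 1 - 2*s by ring]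
    have hp1 : 0 < (1-t) ^ (1 - 2*s) := by positivity
    have hp2 : 0 < (2:ℝ) ^ (1 - 2*s) := by positivity
    refine ⟨fun h => ?_, fun h => ?_, fun h => ?_⟩
    · have := fin 1 (by norm_num) (by
        rw [hI h.ne, mul_one]
        refine le_trans ?_ hDa
        have : 0 < 1 - 2*s := by linarith
        rw [abs_of_pos this]
        gcongr
        linarith)
      linarith
    · obtain ⟨l1, l2⟩ := aux_log _ hd0 hd1
      apply fin _ l1
      have e : ∀ x : ℝ, x ^ (-(2*s)) = x⁻¹ := by
        intro x; rw [h, ← Real.rpow_neg_one]; norm_num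
      simp only [e]
      rw [integral_inv h0]
      nlinarith
    · have hneg : 1 - 2*s < 0 := by linarith
      apply fin
      · have := Real.one_le_rpow_of_pos_of_le_one_of_nonpos hd0 (by linarith) hneg.le
        linarith
      · rw [hI h.ne']
        rw [abs_of_neg hneg] at hDc
        have e : (2 ^ (1 - 2*s) - (1-t) ^ (1 - 2*s)) / (1 - 2*s) =
            ((1-t) ^ (1 - 2*s) - 2 ^ (1 - 2*s)) * (1 / -(1 - 2*s)) := by
          rw [one_div, inv_neg, div_eq_mul_inv]; ring
        rw [e]
        have : 0 < 1 / -(1 - 2*s) := by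
          apply one_div_pos.2; linarith
        nlinarith
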